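/- Let H be an infinite-dimensional complex Hilbert space, let r be a positive rational number with r > 1, and let φ : B(H) → B(H) be a surjective map satisfying σ(|A|^r B) = σ(|φ(A)|^r φ(B)) for all A, B ∈ B(H). Then for every A ∈ B(H), A has rank one if and only if φ(A) has rank one. -/

import Mathlib

/-- The absolute value `|A| = (A* A)^(1/2)`, via the continuous functional calculus. -/
noncomputable def absOp {H : Type*} [NormedAddCommGroup H] [InnerProductSpace ℂ H]
    [CompleteSpace H] (A : H →L[ℂ] H) : H →L[ℂ] H :=
  cfc (fun t : ℝ => Real.sqrt t) (star A * A)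

/-- The power `|A|^r`, via the continuous functional calculus. -/
noncomputable def absPow {H : Type*} [NormedAddCommGroup H] [InnerProductSpace ℂ H]
    [CompleteSpace H] (A : H →L[ℂ] H) (r : ℝ) : H →L[ℂ] H :=
  cfc (fun t : ℝ => t ^ r) (absOp A)

/-- An operator has rank one when its range is a one-dimensional subspace. -/
def IsRankOne {H : Type*} [NormedAddCommGroup H] [InnerProductSpace ℂ H]
    (A : H →L[ℂ] H) : Prop :=
  Module.finrank ℂ (LinearMap.range (A : H →ₗ[ℂ] H)) = 1

/-- A rank-one projection: a self-adjoint idempotent of rank one. -/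
def IsRankOneProjection {H : Type*} [NormedAddCommGroup H] [InnerProductSpace ℂ H]
    [CompleteSpace H] (A : H →L[ℂ] H) : Prop :=
  IsSelfAdjoint A ∧ A * A = A ∧ IsRankOne A

open scoped InnerProductSpace


section helpers

variable {H : Type*} [NormedAddCommGroup H] [InnerProductSpace ℂ H] [CompleteSpace H]

theorem aux_ker_pow (T : H →L[ℂ] H) (hT : IsSelfAdjoint T) (n : ℕ) (x : H) :
    (T ^ (n + 1)) x = 0 ↔ T x = 0 := by
  induction n with
  | zero => simp
  | succ n ih =>
    rw [← ih]
    constructor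
    · intro h
      rw [pow_succ', pow_succ', mul_apply_eq_comp, mul_apply_eq_comp] at h
      rw [pow_succ', mul_apply_eq_comp]
      set y := (T ^ n) x
      have h1 : ⟪T y, T y⟫_ℂ = 0 := by
        have := (ContinuousLinearMap.isSelfAdjoint_iff_isSymmetric.mp hT) (T y) y
        simp only [ContinuousLinearMap.coe_coe] at this
        rw [← this, h, inner_zero_left]
      exact inner_self_eq_zero.mp h1
    · intro h
      rw [pow_succ', mul_apply_eq_comp, h, map_zero]

theorem aux_absPow_sa (A : H →L[ℂ] H) (r : ℝ) : IsSelfAdjoint (absPow A r) := by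
  unfold absPow; exact cfc_predicate _ _

theorem aux_absPow_pow (A : H →L[ℂ] H) (r : ℚ) (hr : 1 < r) :
    (absPow A r) ^ (2 * r.den) = (star A * A) ^ r.num.toNat := by
  have hS : IsSelfAdjoint (star A * A) := IsSelfAdjoint.star_mul_self A
  have hS0 : 0 ≤ star A * A := star_mul_self_nonneg A
  have hr0 : (0:ℝ) ≤ r := by exact_mod_cast (by linarith : (0:ℚ) ≤ r)
  have hcr : Continuous (fun t : ℝ => t ^ (r:ℝ)) := Real.continuous_rpow_const hr0
  have hcs : Continuous (fun t : ℝ => Real.sqrt t) := Real.continuous_sqrt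
  have e1 : absPow A r = cfc (fun t : ℝ => (Real.sqrt t) ^ (r:ℝ)) (star A * A) := by
    unfold absPow absOp
    rw [← cfc_comp' (fun t : ℝ => t ^ (r:ℝ)) (fun t : ℝ => Real.sqrt t) (star A * A)
      hcr.continuousOn hcs.continuousOn hS]
  have hcc : Continuous (fun t : ℝ => (Real.sqrt t) ^ (r:ℝ)) := hcr.comp hcs
  rw [e1, ← cfc_pow _ _ _ hcc.continuousOn hS, ← cfc_pow_id (R := ℝ) (star A * A) _ hS]
  apply cfc_congr
  intro t ht
  have ht0 : 0 ≤ t := spectrum_nonneg_of_nonneg hS0 ht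
  have hd : (r:ℝ) * r.den = (r.num.toNat : ℝ) := by
    have h1 : (r * r.den : ℚ) = r.num := Rat.mul_den_eq_num r
    have h2 : ((r.num.toNat : ℤ)) = r.num := Int.toNat_of_nonneg (Rat.num_nonneg.mpr (by linarith))
    have h3 : (r * r.den : ℚ) = ((r.num.toNat : ℤ) : ℚ) := by rw [h1, h2]
    exact_mod_cast h3
  simp only
  have hs := Real.sqrt_nonneg t
  rw [← Real.rpow_natCast, ← Real.rpow_mul hs, ← Real.rpow_natCast, ← hd]
  conv_rhs => rw [← Real.sq_sqrt ht0]
  rw [← Real.rpow_natCast, ← Real.rpow_mul hs]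
  congr 1
  push_cast
  ring

theorem aux_ker (A : H →L[ℂ] H) (r : ℚ) (hr : 1 < r) (x : H) : absPow A r x = 0 ↔ A x = 0 := by
  have h := aux_absPow_pow A r hr
  have hd : 2 * r.den = (2 * r.den - 1) + 1 := by have := r.den_pos; omega
  have hn : r.num.toNat = (r.num.toNat - 1) + 1 := by
    have : 0 < r.num := Rat.num_pos.mpr (by linarith)
    omega
  rw [hd, hn] at h
  rw [← aux_ker_pow _ (aux_absPow_sa A r) (2 * r.den - 1) x, h,
    aux_ker_pow _ (IsSelfAdjoint.star_mul_self A)]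
  rw [mul_apply_eq_comp, ContinuousLinearMap.star_eq_adjoint]
  constructor
  · intro h
    have : ⟪A x, A x⟫_ℂ = 0 := by
      rw [← ContinuousLinearMap.adjoint_inner_left, h, inner_zero_left]
    exact inner_self_eq_zero.mp this
  · intro h
    rw [h, map_zero]

theorem aux_rank (A : H →L[ℂ] H) (r : ℚ) (hr : 1 < r) :
    IsRankOne A ↔ IsRankOne (absPow A r) := by
  unfold IsRankOne
  have hk : LinearMap.ker (absPow A r : H →ₗ[ℂ] H) = LinearMap.ker (A : H →ₗ[ℂ] H) := by
    ext x
    simpa using aux_ker A r hr x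
  rw [← (LinearMap.quotKerEquivRange (A : H →ₗ[ℂ] H)).finrank_eq,
    ← (LinearMap.quotKerEquivRange (absPow A r : H →ₗ[ℂ] H)).finrank_eq, hk]

theorem aux_eig (S : H →L[ℂ] H) (c : ℂ) (x : H) (hx : x ≠ 0) (h : S x = c • x) :
    c ∈ spectrum ℂ S := by
  rw [spectrum.mem_iff]
  intro hu
  obtain ⟨u, hu⟩ := hu
  apply hx
  have h1 : (u : H →L[ℂ] H) x = 0 := by
    rw [hu]; simp [Algebra.algebraMap_eq_smul_one, h]
  have h2 : ((↑u⁻¹ : H →L[ℂ] H) * u) x = x := by simp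
  rw [← h2, mul_apply_eq_comp, h1, map_zero]

theorem aux_char (T : H →L[ℂ] H) :
    IsRankOne T ↔ (∀ B : H →L[ℂ] H, ∀ a ∈ spectrum ℂ (T * B), ∀ b ∈ spectrum ℂ (T * B),
      a ≠ 0 → b ≠ 0 → a = b) ∧ ∃ B : H →L[ℂ] H, ∃ a ∈ spectrum ℂ (T * B), a ≠ 0 := by
  have hB : ∀ e u : H, e ≠ 0 → ∃ f : StrongDual ℂ H, f e = 1 := fun e u he =>
    SeparatingDual.exists_eq_one he
  unfold IsRankOne
  constructor
  · intro h
    obtain ⟨⟨v, hv⟩, hv0, hspan⟩ := finrank_eq_one_iff'.mp h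
    have hv0' : v ≠ 0 := fun h => hv0 (by simp [h])
    have hT : ∀ x, ∃ c : ℂ, c • v = T x := fun x => by
      obtain ⟨c, hc⟩ := hspan ⟨T x, ⟨x, rfl⟩⟩
      exact ⟨c, congrArg Subtype.val hc⟩
    refine ⟨?_, ?_⟩
    · intro B
      obtain ⟨c, hc⟩ := hT (B v)
      have key : ∀ a ∈ spectrum ℂ (T * B), a ≠ 0 → a = c := by
        intro a ha ha0
        have hz : (T * B) * (T * B) - c • (T * B) = 0 := by
          ext x
          obtain ⟨d, hd⟩ := hT (B x)
          simp only [ContinuousLinearMap.sub_apply, mul_apply_eq_comp,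
            ContinuousLinearMap.smul_apply, ContinuousLinearMap.zero_apply]
          rw [← hd, map_smul, map_smul, ← hc, smul_comm, sub_self]
        have := spectrum.subset_polynomial_aeval (T * B)
          (Polynomial.X * Polynomial.X - Polynomial.C c * Polynomial.X) ⟨a, ha, rfl⟩
        simp only [map_sub, map_mul, Polynomial.aeval_X, Polynomial.aeval_C, Polynomial.eval_sub,
          Polynomial.eval_mul, Polynomial.eval_X, Polynomial.eval_C, ← Algebra.smul_def] at this
        rw [hz] at this
        have hnt : Nontrivial H := ⟨v, 0, hv0'⟩
        rw [spectrum.zero_eq, Set.mem_singleton_iff] at this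
        have h3 : a * (a - c) = 0 := by linear_combination this
        rcases mul_eq_zero.mp h3 with h | h
        · exact absurd h ha0
        · exact sub_eq_zero.mp h
      intro a ha b hb ha0 hb0
      rw [key a ha ha0, key b hb hb0]
    · obtain ⟨u, hu⟩ := hv
      obtain ⟨f, hf⟩ := hB v u hv0'
      refine ⟨f.smulRight u, 1, aux_eig _ _ v hv0' ?_, one_ne_zero⟩
      simp only [ContinuousLinearMap.coe_coe] at hu
      simp [hf, hu]
  · rintro ⟨h1, B, a, ha, ha0⟩
    have hT0 : ∃ u, T u ≠ 0 := by
      by_contra! hcon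
      have : T = 0 := by ext x; simpa using hcon x
      rw [this, zero_mul] at ha
      rcases subsingleton_or_nontrivial H with hs | hs
      · rw [spectrum.mem_iff] at ha
        exact ha (isUnit_of_subsingleton _)
      · rw [spectrum.zero_eq] at ha
        exact ha0 ha
    obtain ⟨u, hu⟩ := hT0
    apply finrank_eq_one_iff'.mpr
    refine ⟨⟨T u, ⟨u, rfl⟩⟩, fun h => hu (congrArg Subtype.val h), ?_⟩
    rintro ⟨_, ⟨v, rfl⟩⟩
    by_contra! hcon
    obtain ⟨f, hf⟩ := hB (T u) u hu
    -- replace v by w with f (T w) = 0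
    set w := v - f (T v) • u with hw
    have hfw : f (T w) = 0 := by simp [hw, hf]
    have hw0 : T w ≠ 0 := by
      intro h
      apply hcon (f (T v))
      apply Subtype.ext
      have : T v - f (T v) • T u = 0 := by rw [← h, hw]; simp
      exact (sub_eq_zero.mp this).symm
    obtain ⟨g, hg⟩ := hB (T w) u hw0
    have e1 := h1 (f.smulRight u + (2:ℂ) • (g - g (T u) • f).smulRight w) 1
      (aux_eig _ _ (T u) hu (by simp [hf])) 2
      (aux_eig _ _ (T w) hw0 (by simp [hfw, hg])) one_ne_zero two_ne_zero
    norm_num at e1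

end helpers

theorem bounded_preserver_rankOne
    {H : Type*} [NormedAddCommGroup H] [InnerProductSpace ℂ H] [CompleteSpace H]
    (hH : ¬ FiniteDimensional ℂ H)
    (r : ℚ) (hr : 1 < r)
    (φ : (H →L[ℂ] H) → (H →L[ℂ] H))
    (hφ : Function.Surjective φ)
    (hspec : ∀ A B : H →L[ℂ] H,
      spectrum ℂ (absPow A r * B) = spectrum ℂ (absPow (φ A) r * φ B)):
    ∀ A : H →L[ℂ] H, IsRankOne A ↔ IsRankOne (φ A) := by
  intro A
  rw [aux_rank A r hr, aux_rank (φ A) r hr, aux_char, aux_char (absPow (φ A) r), and_congr]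
  · simp only [hspec A]
    exact (hφ.forall (p := fun B => ∀ a ∈ spectrum ℂ (absPow (φ A) r * B),
      ∀ b ∈ spectrum ℂ (absPow (φ A) r * B), a ≠ 0 → b ≠ 0 → a = b)).symm
  · simp only [hspec A]
    exact (hφ.exists (p := fun B => ∃ a ∈ spectrum ℂ (absPow (φ A) r * B), a ≠ 0)).symm
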